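/- Conjugate gradient terminates in r steps when A has r distinct eigenvalues: let A be a d×d real symmetric positive definite matrix having exactly r distinct eigenvalues, b ∈ ℝ^d, and run the conjugate gradient iteration (g_t = A x_t − b, d₁ = −g₁, d_t = −g_t + β_t d_{t−1} with β_t = g_tᵀAd_{t−1}/(d_{t−1}ᵀAd_{t−1}), x_{t+1} = x_t + η_t d_t with η_t = −d_tᵀg_t/(d_tᵀAd_t)) from any x₁ ∈ ℝ^d. Then the error vanishes after at most r iterations: provided the iterates are defined (the gradients are nonzero) up to step r, x_{r+1} = A⁻¹ b. -/

import Mathlib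

open Matrix

/-- Invariants of the conjugate gradient recursion (indices shifted to start at 0). -/
theorem cg_invariants {d : ℕ} (A : Matrix (Fin d) (Fin d) ℝ) (hA : A.PosDef)
    (G D : ℕ → Fin d → ℝ) (η β : ℕ → ℝ)
    (hD0 : D 0 = -G 0)
    (hβ : ∀ n, β n = (G (n + 1) ⬝ᵥ A *ᵥ D n) / (D n ⬝ᵥ A *ᵥ D n))
    (hη : ∀ n, η n = -(D n ⬝ᵥ G n) / (D n ⬝ᵥ A *ᵥ D n))
    (hD : ∀ n, D (n + 1) = -G (n + 1) + β n • D n)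
    (hG : ∀ n, G (n + 1) = G n + η n • A *ᵥ D n)
    (N : ℕ) (hnz : ∀ n ≤ N, G n ≠ 0) :
    ∀ n ≤ N, ((∀ i < n, G n ⬝ᵥ D i = 0) ∧ (∀ i < n, D n ⬝ᵥ A *ᵥ D i = 0) ∧
      (∀ i < n, G n ⬝ᵥ G i = 0) ∧ D n ⬝ᵥ A *ᵥ D n ≠ 0 ∧ η n ≠ 0) := by
  have hsymm : ∀ u v : Fin d → ℝ, u ⬝ᵥ A *ᵥ v = v ⬝ᵥ A *ᵥ u := by
    intro u v
    have hT : Aᵀ = A := by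
      have h : A.IsSymm := by simpa using hA.1
      exact h
    rw [dotProduct_mulVec, ← mulVec_transpose, hT, dotProduct_comm]
  have hpos : ∀ u : Fin d → ℝ, u ≠ 0 → u ⬝ᵥ A *ᵥ u ≠ 0 := by
    intro u hu
    have := hA.dotProduct_mulVec_pos hu
    simpa using this.ne'
  have key : ∀ n ≤ N, D n ⬝ᵥ G n = -(G n ⬝ᵥ G n) →
      D n ⬝ᵥ A *ᵥ D n ≠ 0 ∧ η n ≠ 0 := by
    intro n hn h
    have h1 : G n ⬝ᵥ G n ≠ 0 := fun h0 => hnz n hn (dotProduct_self_eq_zero.1 h0)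
    have h2 : D n ≠ 0 := by
      intro h0
      rw [h0, zero_dotProduct] at h
      exact h1 (by linarith)
    have h3 := hpos _ h2
    refine ⟨h3, ?_⟩
    rw [hη, h, neg_neg]
    exact div_ne_zero h1 h3
  intro n
  induction n using Nat.strong_induction_on with
  | _ n ih =>
  intro hn
  cases n with
  | zero =>
    refine ⟨by simp, by simp, by simp, ?_⟩
    apply key 0 hn
    rw [hD0, neg_dotProduct]
  | succ n =>
    obtain ⟨ha, hb, hc, hd, he⟩ := ih n (by omega) (by omega)
    have ha' : ∀ i < n + 1, G (n + 1) ⬝ᵥ D i = 0 := by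
      intro i hi
      rw [hG, add_dotProduct, smul_dotProduct, smul_eq_mul]
      rcases Nat.lt_succ_iff_lt_or_eq.1 hi with h | h
      · rw [ha i h, dotProduct_comm, hsymm, hb i h]; simp
      · subst h
        rw [hη, dotProduct_comm (A *ᵥ D i) (D i), div_mul_cancel₀ _ hd, dotProduct_comm]
        ring
    have hc' : ∀ i < n + 1, G (n + 1) ⬝ᵥ G i = 0 := by
      intro i hi
      cases i with
      | zero =>
        have : G 0 = - D 0 := by rw [hD0, neg_neg]
        rw [this, dotProduct_neg, ha' 0 hi, neg_zero]
      | succ i =>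
        have : G (i + 1) = - D (i + 1) + β i • D i := by rw [hD]; abel
        rw [this, dotProduct_add, dotProduct_neg, dotProduct_smul, ha' _ hi,
          ha' i (by omega)]
        simp
    refine ⟨ha', ?_, hc', ?_⟩
    · intro i hi
      rw [hD, add_dotProduct, neg_dotProduct, smul_dotProduct, smul_eq_mul]
      rcases Nat.lt_succ_iff_lt_or_eq.1 hi with h | h
      · obtain ⟨-, -, -, -, hei⟩ := ih i (by omega) (by omega)
        have h1 : G (n + 1) ⬝ᵥ G (i + 1) = 0 := hc' _ (by omega)
        rw [hG i, dotProduct_add, dotProduct_smul, hc' i hi, smul_eq_mul, zero_add] at h1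
        rw [(mul_eq_zero.1 h1).resolve_left hei, hb i h]; simp
      · subst h
        rw [hβ, div_mul_cancel₀ _ hd]; ring
    · apply key _ hn
      rw [hD, add_dotProduct, neg_dotProduct, smul_dotProduct, dotProduct_comm (D n),
        ha' n (by omega)]
      simp

/-- Any vector lies in an `A`-invariant subspace whose dimension is at most the number of
distinct eigenvalues. -/
theorem exists_invariant {d : ℕ} (A : Matrix (Fin d) (Fin d) ℝ) (hA : A.IsHermitian)
    (v : Fin d → ℝ) : ∃ K : Submodule ℝ (Fin d → ℝ), v ∈ K ∧ (∀ u ∈ K, A *ᵥ u ∈ K) ∧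
      Module.finrank ℝ K ≤ (Set.range hA.eigenvalues).ncard := by
  classical
  let e : Fin d → Fin d → ℝ := fun j => WithLp.ofLp (hA.eigenvectorBasis j)
  let c : Fin d → ℝ := fun j => hA.eigenvectorBasis.repr (WithLp.toLp 2 v) j
  have he : ∀ j, A *ᵥ e j = hA.eigenvalues j • e j := fun j => hA.mulVec_eigenvectorBasis j
  have hv : ∑ j, c j • e j = v := by
    have := congrArg WithLp.ofLp (hA.eigenvectorBasis.sum_repr (WithLp.toLp 2 v))
    simpa [WithLp.ofLp_sum] using this
  let S : Finset ℝ := Finset.univ.image hA.eigenvalues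
  let w : ℝ → Fin d → ℝ := fun l => ∑ j with hA.eigenvalues j = l, c j • e j
  have hw : ∀ l, A *ᵥ w l = l • w l := by
    intro l
    simp only [w]
    rw [mulVec_sum, Finset.smul_sum]
    refine Finset.sum_congr rfl fun j hj => ?_
    rw [mulVec_smul, he, (Finset.mem_filter.1 hj).2, smul_comm]
  have hvw : ∑ l ∈ S, w l = v := by
    rw [← hv]
    exact Finset.sum_fiberwise_of_maps_to (fun j _ => Finset.mem_image_of_mem _ (Finset.mem_univ j)) _
  refine ⟨Submodule.span ℝ (S.image w : Finset (Fin d → ℝ)), ?_, ?_, ?_⟩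
  · rw [← hvw]
    exact Submodule.sum_mem _ fun l hl =>
      Submodule.subset_span (Finset.mem_coe.2 (Finset.mem_image_of_mem _ hl))
  · intro u hu
    induction hu using Submodule.span_induction with
    | mem u hu =>
      obtain ⟨l, hl, rfl⟩ := Finset.mem_image.1 (Finset.mem_coe.1 hu)
      rw [hw]
      exact Submodule.smul_mem _ _ (Submodule.subset_span hu)
    | zero => simp
    | add a b _ _ ha hb => rw [mulVec_add]; exact Submodule.add_mem _ ha hb
    | smul a b _ hb => rw [mulVec_smul]; exact Submodule.smul_mem _ _ hb
  · refine (finrank_span_finset_le_card _).trans (Finset.card_image_le.trans ?_)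
    rw [← Set.ncard_coe_finset]
    simp [S]

/-- Conjugate gradient terminates in `r` steps when `A` has exactly `r`
distinct eigenvalues: for a symmetric positive definite `A` whose set of
eigenvalues has cardinality `r`, running the conjugate gradient iteration
(`g t = A (x t) − b`, `dd 1 = −g 1`,
`dd t = −g t + β_t • dd (t−1)` with
`β_t = (g tᵀ A dd (t−1))/(dd (t−1)ᵀ A dd (t−1))`,
`x (t+1) = x t + η_t • dd t` with `η_t = −(dd tᵀ g t)/(dd tᵀ A dd t)`)
from any starting point, provided the gradients are nonzero up to step `r`,
we have `x (r+1) = A⁻¹ b`. -/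
theorem conjugate_gradient_r_distinct_eigenvalues {d : ℕ}
    (A : Matrix (Fin d) (Fin d) ℝ) (hA : A.PosDef)
    (r : ℕ) (hr : (Set.range hA.1.eigenvalues).ncard = r)
    (b : Fin d → ℝ) (x g dd : ℕ → Fin d → ℝ)
    (hg : ∀ t, g t = A.mulVec (x t) - b)
    (hd1 : dd 1 = -g 1)
    (hdrec : ∀ t, 2 ≤ t → dd t = -g t +
      ((g t ⬝ᵥ A.mulVec (dd (t - 1))) / (dd (t - 1) ⬝ᵥ A.mulVec (dd (t - 1))))
        • dd (t - 1))
    (hx : ∀ t, 1 ≤ t → x (t + 1) = x t +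
      (-(dd t ⬝ᵥ g t) / (dd t ⬝ᵥ A.mulVec (dd t))) • dd t)
    (hnz : ∀ s, 1 ≤ s → s ≤ r → g s ≠ 0) :
    x (r + 1) = A⁻¹.mulVec b := by
  have hinv : ∀ y, A *ᵥ y = b → y = A⁻¹ *ᵥ b := by
    intro y hy
    rw [← hy, mulVec_mulVec, nonsing_inv_mul _ ((isUnit_iff_isUnit_det A).1 hA.isUnit), one_mulVec]
  apply hinv
  by_contra hne
  have hgne : g (r + 1) ≠ 0 := by
    intro h0
    rw [hg] at h0
    exact hne (sub_eq_zero.1 h0)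
  let G : ℕ → Fin d → ℝ := fun n => g (n + 1)
  let D : ℕ → Fin d → ℝ := fun n => dd (n + 1)
  let η : ℕ → ℝ := fun n => -(D n ⬝ᵥ G n) / (D n ⬝ᵥ A *ᵥ D n)
  let β : ℕ → ℝ := fun n => (G (n + 1) ⬝ᵥ A *ᵥ D n) / (D n ⬝ᵥ A *ᵥ D n)
  have hD : ∀ n, D (n + 1) = -G (n + 1) + β n • D n := fun n => hdrec (n + 2) (by omega)
  have hG : ∀ n, G (n + 1) = G n + η n • A *ᵥ D n := by
    intro n
    have h := hx (n + 1) (by omega)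
    simp only [G]
    have h2 := hg (n + 1)
    rw [hg (n + 1 + 1), h, mulVec_add, mulVec_smul, add_sub_right_comm, ← h2]
  have hGnz : ∀ n ≤ r, G n ≠ 0 := by
    intro n hn
    rcases hn.lt_or_eq with h | h
    · exact hnz (n + 1) (by omega) (by omega)
    · subst h; exact hgne
  have hI := cg_invariants A hA G D η β hd1 (fun _ => rfl) (fun _ => rfl) hD hG r hGnz
  obtain ⟨K, hK0, hKA, hKr⟩ := exists_invariant A hA.1 (G 0)
  have hmem : ∀ n, G n ∈ K ∧ D n ∈ K := by
    intro n
    induction n with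
    | zero => exact ⟨hK0, by rw [show D 0 = -G 0 from hd1]; exact K.neg_mem hK0⟩
    | succ n ih =>
      have h1 : G (n + 1) ∈ K := by
        rw [hG]; exact K.add_mem ih.1 (K.smul_mem _ (hKA _ ih.2))
      exact ⟨h1, by rw [hD]; exact K.add_mem (K.neg_mem h1) (K.smul_mem _ ih.2)⟩
  have hort : ∀ i j : Fin (r + 1), i ≠ j → G i ⬝ᵥ G j = 0 := by
    intro i j hij
    have : (i : ℕ) ≠ j := fun h => hij (Fin.ext h)
    rcases lt_or_gt_of_ne this with h | h
    · rw [dotProduct_comm]; exact (hI j (by omega)).2.2.1 i h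
    · exact (hI i (by omega)).2.2.1 j h
  have hli : LinearIndependent ℝ (fun i : Fin (r + 1) => (⟨G i, (hmem i).1⟩ : K)) := by
    apply LinearIndependent.of_comp K.subtype
    rw [Fintype.linearIndependent_iff]
    intro c hc j
    have h := congrArg (fun u => u ⬝ᵥ G j) hc
    simp only [Function.comp, Submodule.subtype_apply, sum_dotProduct, smul_dotProduct,
      zero_dotProduct] at h
    rw [Finset.sum_eq_single j (fun i _ hij => by rw [hort i j hij, smul_zero]) (by simp),
      smul_eq_mul] at h
    exact (mul_eq_zero.1 h).resolve_right
      fun h0 => hGnz j (by omega) (dotProduct_self_eq_zero.1 h0)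
  have := hli.fintype_card_le_finrank
  rw [Fintype.card_fin] at this
  omega
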